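/- Let β ∈ (0,1) and ν > 0. Define f_{β,ν}(t) = e^{−νt} t^{β−1} M_{β,β}((ν^β − 1) t^β) for t > 0, where M_{a,b}(z) = Σ_{n=0}^∞ z^n / Γ(an + b) is the two-parameter Mittag-Leffler function. Then for every s > 0, ∫₀^∞ e^{−st} f_{β,ν}(t) dt = 1 / (1 − ν^β + (ν + s)^β). -/

import Mathlib

open MeasureTheory Real Filter

/-- The two-parameter Mittag-Leffler function `M_{a,b}(z) = ∑ zⁿ / Γ(an + b)`. -/
noncomputable def mittagLeffler (a b z : ℝ) : ℝ :=
  ∑' n : ℕ, z ^ n / Real.Gamma (a * n + b)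

/-- Completely monotone up to order `n` on the positive half line. -/
def CMon : ℕ → (ℝ → ℝ) → Prop
  | 0, f => ∀ x, 0 < x → 0 ≤ f x
  | (n + 1), f => (∀ x, 0 < x → 0 ≤ f x) ∧
      ∃ f' : ℝ → ℝ, (∀ x, 0 < x → HasDerivAt f (-(f' x)) x) ∧ CMon n f'

lemma CMon.nonneg {n : ℕ} {f : ℝ → ℝ} (h : CMon n f) : ∀ x, 0 < x → 0 ≤ f x := by
  cases n with
  | zero => exact h
  | succ n => exact h.1

lemma CMon.pred {n : ℕ} {f : ℝ → ℝ} (h : CMon (n + 1) f) : CMon n f := by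
  induction n generalizing f with
  | zero => exact h.1
  | succ n ih =>
    obtain ⟨h0, f', hf', h'⟩ := h
    exact ⟨h0, f', hf', ih h'⟩

lemma CMon.add {n : ℕ} {f g : ℝ → ℝ} (hf : CMon n f) (hg : CMon n g) :
    CMon n (fun x => f x + g x) := by
  induction n generalizing f g with
  | zero => exact fun x hx => add_nonneg (hf x hx) (hg x hx)
  | succ n ih =>
    obtain ⟨f0, f', hf', h1⟩ := hf
    obtain ⟨g0, g', hg', h2⟩ := hg
    refine ⟨fun x hx => add_nonneg (f0 x hx) (g0 x hx), _, fun x hx => ?_, ih h1 h2⟩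
    exact ((hf' x hx).add (hg' x hx)).congr_deriv (by ring)

lemma CMon.mul {n : ℕ} {f g : ℝ → ℝ} (hf : CMon n f) (hg : CMon n g) :
    CMon n (fun x => f x * g x) := by
  induction n generalizing f g with
  | zero => exact fun x hx => mul_nonneg (hf x hx) (hg x hx)
  | succ n ih =>
    have hf1 := hf.pred
    have hg1 := hg.pred
    obtain ⟨f0, f', hf', h1⟩ := hf
    obtain ⟨g0, g', hg', h2⟩ := hg
    refine ⟨fun x hx => mul_nonneg (f0 x hx) (g0 x hx), _, fun x hx => ?_,
      (ih h1 hg1).add (ih hf1 h2)⟩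
    exact ((hf' x hx).mul (hg' x hx)).congr_deriv (by ring)

lemma CMon_rpow (n : ℕ) (C a : ℝ) (hC : 0 ≤ C) (ha : 0 ≤ a) :
    CMon n (fun x => C * x ^ (-a)) := by
  induction n generalizing C a with
  | zero => exact fun x hx => mul_nonneg hC (rpow_nonneg hx.le _)
  | succ n ih =>
    refine ⟨fun x hx => mul_nonneg hC (rpow_nonneg hx.le _), _, fun x hx => ?_,
      ih (C * a) (a + 1) (by positivity) (by positivity)⟩
    have := (Real.hasDerivAt_rpow_const (x := x) (p := -a) (Or.inl hx.ne')).const_mul C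
    refine this.congr_deriv ?_
    rw [show -(a+1) = -a - 1 by ring]
    ring

lemma CMon_F (β l : ℝ) (hβ : β ∈ Set.Ioo (0 : ℝ) 1) (hl : 0 ≤ l) (n : ℕ) :
    CMon n (fun x => 1 / (x ^ β + l)) := by
  have h0 : ∀ x : ℝ, 0 < x → 0 < x ^ β + l := fun x hx => by
    have := rpow_pos_of_pos hx β
    positivity
  induction n with
  | zero => exact fun x hx => one_div_nonneg.2 (h0 x hx).le
  | succ n ih =>
    refine ⟨fun x hx => one_div_nonneg.2 (h0 x hx).le, _, fun x hx => ?_,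
      (CMon_rpow n β (1 - β) hβ.1.le (by linarith [hβ.2])).mul (ih.mul ih)⟩
    have h1 := ((Real.hasDerivAt_rpow_const (x := x) (p := β) (Or.inl hx.ne')).add_const l)
    have := h1.inv (h0 x hx).ne'
    simp only [one_div]
    refine HasDerivAt.congr_deriv (f := fun x => (x ^ β + l)⁻¹) this ?_
    rw [show -(1 - β) = β - 1 by ring]
    field_simp

lemma CMon.diff {n : ℕ} {f : ℝ → ℝ} (h : CMon (n + 1) f) {δ : ℝ} (hδ : 0 < δ) :
    CMon n (fun x => f x - f (x + δ)) := by
  have key : ∀ f : ℝ → ℝ, CMon 1 f → ∀ x, 0 < x → 0 ≤ f x - f (x + δ) := by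
    rintro f ⟨_, f', hf', h'⟩ x hx
    have : AntitoneOn f (Set.Ioi 0) := by
      apply antitoneOn_of_deriv_nonpos (convex_Ioi 0)
      · exact fun y hy => (hf' y hy).continuousAt.continuousWithinAt
      · rw [interior_Ioi]
        exact fun y hy => (hf' y hy).differentiableAt.differentiableWithinAt
      · rw [interior_Ioi]
        intro y hy
        rw [(hf' y hy).deriv]
        linarith [h' y hy]
    have := this (show x ∈ Set.Ioi 0 from hx) (show x + δ ∈ Set.Ioi 0 by simp; linarith)
      (by linarith)
    linarith
  induction n generalizing f with
  | zero => exact key f h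
  | succ n ih =>
    have h1 : CMon 1 f := by
      obtain ⟨h0, f', hf', h'⟩ := h
      exact ⟨h0, f', hf', h'.nonneg⟩
    obtain ⟨h0, f', hf', h'⟩ := h
    refine ⟨key f h1, _, fun x hx => ?_, ih h'⟩
    have e := (hf' (x + δ) (by linarith)).comp_add_const x δ
    exact ((hf' x hx).sub e).congr_deriv (by ring)

/-- Iterated backward differences. -/
def Dif (δ : ℝ) (F : ℝ → ℝ) : ℕ → ℝ → ℝ
  | 0 => F
  | (k + 1) => fun x => Dif δ F k x - Dif δ F k (x + δ)

lemma Dif_nonneg {F : ℝ → ℝ} (hF : ∀ n, CMon n F) {δ : ℝ} (hδ : 0 < δ) (k : ℕ) :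
    ∀ x, 0 < x → 0 ≤ Dif δ F k x := by
  have : ∀ k n, CMon n (Dif δ F k) := by
    intro k
    induction k with
    | zero => exact hF
    | succ k ih => exact fun n => (ih (n + 1)).diff hδ
  exact (this k 0)

lemma Dif_sum (F : ℝ → ℝ) (δ x : ℝ) (N : ℕ) :
    F x = (∑ k ∈ Finset.range N, Dif δ F k (x + δ)) + Dif δ F N x := by
  induction N with
  | zero => simp [Dif]
  | succ N ih =>
    rw [Finset.sum_range_succ, ih]
    simp only [Dif]
    ring

/-- The kernel. -/
noncomputable def gker (β c t : ℝ) : ℝ := t ^ (β - 1) * mittagLeffler β β (c * t ^ β)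

lemma direct (β c p : ℝ) (hβ : 0 < β) (hp : 0 < p) (hc : |c| < p ^ β) :
    ∫ t in Set.Ioi (0 : ℝ), exp (-p * t) * gker β c t = 1 / (p ^ β - c) := by
  have hpb := rpow_pos_of_pos hp β
  set T : ℕ → ℝ → ℝ := fun n t => c ^ n / Gamma (β * n + β) *
    (t ^ ((β * n + β) - 1) * exp (-(p * t))) with hT
  have hpos : ∀ n : ℕ, 0 < β * n + β := fun n => by positivity
  have hI : ∀ n : ℕ, ∫ t in Set.Ioi (0 : ℝ), t ^ ((β * n + β) - 1) * exp (-(p * t)) =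
      (1 / p) ^ (β * n + β) * Gamma (β * n + β) := fun n =>
    Real.integral_rpow_mul_exp_neg_mul_Ioi (hpos n) hp
  have hint0 : ∀ n : ℕ, Integrable (fun t => t ^ ((β * n + β) - 1) * exp (-(p * t)))
      (volume.restrict (Set.Ioi (0 : ℝ))) := fun n => by
    apply Integrable.of_integral_ne_zero
    rw [hI]
    have := Gamma_pos_of_pos (hpos n)
    positivity
  have hpow : ∀ n : ℕ, (1 / p) ^ (β * n + β) = (p ^ β)⁻¹ * ((p ^ β)⁻¹) ^ n := fun n => by
    rw [one_div, inv_rpow hp.le, rpow_add hp, rpow_mul hp.le, rpow_natCast, mul_inv, inv_pow]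
    ring
  have hsum := hasSum_integral_of_summable_integral_norm (F := T)
    (μ := volume.restrict (Set.Ioi (0 : ℝ))) (fun n => (hint0 n).const_mul _) (by
      have : ∀ n, ∫ t in Set.Ioi (0 : ℝ), ‖T n t‖ = (p ^ β)⁻¹ * (|c| / p ^ β) ^ n := by
        intro n
        have hG := Gamma_pos_of_pos (hpos n)
        have : ∀ t ∈ Set.Ioi (0 : ℝ), ‖T n t‖ = |c| ^ n / Gamma (β * n + β) *
            (t ^ ((β * n + β) - 1) * exp (-(p * t))) := by
          intro t ht
          have h0 : 0 ≤ t ^ ((β * n + β) - 1) * exp (-(p * t)) :=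
            mul_nonneg (rpow_nonneg (le_of_lt ht) _) (exp_pos _).le
          rw [hT, norm_mul, norm_div, norm_pow, Real.norm_of_nonneg h0, Real.norm_of_nonneg hG.le,
            Real.norm_eq_abs]
        rw [setIntegral_congr_fun measurableSet_Ioi this, integral_const_mul, hI, hpow, div_pow, inv_pow]
        field_simp
      simp_rw [this]
      apply Summable.mul_left
      apply summable_geometric_of_lt_one (by positivity)
      rwa [div_lt_one hpb])
  have h2 : HasSum (fun n => ∫ t in Set.Ioi (0 : ℝ), T n t) ((p ^ β)⁻¹ * (1 - c / p ^ β)⁻¹) := by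
    have : ∀ n, ∫ t in Set.Ioi (0 : ℝ), T n t = (p ^ β)⁻¹ * (c / p ^ β) ^ n := by
      intro n
      have hG := Gamma_pos_of_pos (hpos n)
      rw [hT, integral_const_mul, hI, hpow, div_pow, inv_pow]
      field_simp
    simp_rw [this]
    apply HasSum.mul_left
    apply hasSum_geometric_of_norm_lt_one
    rw [norm_div, Real.norm_eq_abs, Real.norm_eq_abs, abs_of_pos hpb]
    rwa [div_lt_one hpb]
  have h3 := hsum.unique h2
  have h4 : ∀ t ∈ Set.Ioi (0 : ℝ), exp (-p * t) * gker β c t = ∑' n, T n t := by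
    intro t ht
    have ht : 0 < t := ht
    rw [gker, mittagLeffler, ← tsum_mul_left, ← tsum_mul_left]
    congr 1; ext n
    rw [hT]
    simp only
    rw [show β * n + β - 1 = (β - 1) + β * n by ring, rpow_add ht, rpow_mul ht.le, rpow_natCast,
      mul_pow, neg_mul]
    ring
  rw [setIntegral_congr_fun measurableSet_Ioi h4, h3]
  have : p ^ β - c ≠ 0 := by have := (abs_lt.1 hc).2; linarith
  field_simp

lemma summable_ml (β R : ℝ) (hβ : 0 < β) (hR : 0 < R) :
    Summable (fun n : ℕ => R ^ n / Gamma (β * n + β)) := by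
  -- `Γ(x) ≥ (Q)^(x-1) e^{-(Q+1)}` for `x ≥ 1`
  set Q := (2 * R) ^ (1 / β) with hQ
  have hQ0 : 0 < Q := by positivity
  have hQb : Q ^ β = 2 * R := by
    rw [hQ, ← rpow_mul (by positivity)]; field_simp; simp
  have hlow : ∀ x : ℝ, 1 ≤ x → Q ^ (x - 1) * exp (-(Q + 1)) ≤ Gamma x := by
    intro x hx
    rw [Gamma_eq_integral (by linarith)]
    calc Q ^ (x - 1) * exp (-(Q + 1)) = ∫ t in Set.Ioc Q (Q + 1), exp (-(Q + 1)) * Q ^ (x - 1) := by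
          simp; ring
      _ ≤ ∫ t in Set.Ioc Q (Q + 1), exp (-t) * t ^ (x - 1) := by
          apply setIntegral_mono_on
          · exact integrableOn_const (by simp)
          · exact (GammaIntegral_convergent (by linarith)).mono_set
              (fun t ht => lt_trans hQ0 ht.1)
          · exact measurableSet_Ioc
          · intro t ht
            have h1 := ht.1
            have h2 := ht.2
            gcongr
      _ ≤ _ := by
          apply setIntegral_mono_set (GammaIntegral_convergent (by linarith))
          · filter_upwards [ae_restrict_mem measurableSet_Ioi] with t ht
            exact mul_nonneg (exp_pos _).le (rpow_nonneg (le_of_lt ht) _)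
          · exact LE.le.eventuallyLE (fun t ht => lt_trans hQ0 ht.1)
  have hgeo : Summable (fun n : ℕ => (Q ^ (β - 1) * exp (-(Q + 1)))⁻¹ * (1 / 2 : ℝ) ^ n) :=
    (summable_geometric_of_lt_one (by norm_num) (by norm_num)).mul_left _
  apply Summable.of_norm_bounded_eventually_nat hgeo
  filter_upwards [eventually_ge_atTop ⌈1 / β⌉₊] with n hn
  have hn' : 1 / β ≤ n := Nat.ceil_le.1 hn
  have hx : 1 ≤ β * n + β := by
    rw [div_le_iff₀ hβ] at hn'
    linarith
  have h1 := hlow _ hx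
  have hG : 0 < Gamma (β * n + β) := Gamma_pos_of_pos (by linarith)
  have h5 : Q ^ (β * n + β - 1) = Q ^ (β - 1) * (2 * R) ^ n := by
    rw [show β * n + β - 1 = (β - 1) + β * n by ring, rpow_add hQ0, rpow_mul hQ0.le, hQb,
      rpow_natCast]
  rw [h5] at h1
  rw [Real.norm_of_nonneg (by positivity)]
  calc R ^ n / Gamma (β * n + β) ≤ R ^ n / (Q ^ (β - 1) * (2 * R) ^ n * exp (-(Q + 1))) := by
        gcongr
    _ = _ := by
        rw [mul_pow]
        have := rpow_pos_of_pos hQ0 (β - 1)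
        have := exp_pos (-(Q+1))
        rw [one_div, inv_pow]
        field_simp

lemma continuous_ml (β : ℝ) (hβ : 0 < β) : Continuous (mittagLeffler β β) := by
  rw [continuous_iff_continuousAt]
  intro z
  have : ContinuousOn (mittagLeffler β β) (Metric.ball 0 (|z| + 1)) := by
    apply continuousOn_tsum (u := fun n : ℕ => (|z| + 1) ^ n / Gamma (β * n + β))
    · intro n
      fun_prop
    · exact summable_ml β _ hβ (by positivity)
    · intro n x hx
      have hG : 0 < Gamma (β * n + β) := Gamma_pos_of_pos (by positivity)
      rw [norm_div, norm_pow, Real.norm_of_nonneg hG.le]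
      rw [mem_ball_zero_iff] at hx
      gcongr
  exact this.continuousAt (Metric.isOpen_ball.mem_nhds (by simp))

lemma continuousOn_gker (β c : ℝ) (hβ : 0 < β) : ContinuousOn (gker β c) (Set.Ioi 0) := by
  intro t ht
  have ht : 0 < t := ht
  have h1 : ∀ a : ℝ, ContinuousAt (fun t : ℝ => t ^ a) t := fun a =>
    continuousAt_rpow_const t a (Or.inl ht.ne')
  apply ContinuousAt.continuousWithinAt
  exact (h1 _).mul ((continuous_ml β hβ).continuousAt.comp (continuousAt_const.mul (h1 β)))

section generic

variable {F g : ℝ → ℝ} {L : ℝ}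

lemma gen_int (hFpos : ∀ x, 0 < x → 0 < F x) (hL0 : 0 ≤ L)
    (hL : ∀ q, L < q → ∫ t in Set.Ioi (0 : ℝ), exp (-q * t) * g t = F q) (q : ℝ) (hq : L < q) :
    Integrable (fun t => exp (-q * t) * g t) (volume.restrict (Set.Ioi (0 : ℝ))) := by
  apply Integrable.of_integral_ne_zero
  rw [hL q hq]
  exact (hFpos q (by linarith)).ne'

lemma gen_int_k (hFpos : ∀ x, 0 < x → 0 < F x) (hL0 : 0 ≤ L)
    (hL : ∀ q, L < q → ∫ t in Set.Ioi (0 : ℝ), exp (-q * t) * g t = F q) {δ : ℝ} (hδ : 0 < δ)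
    (k : ℕ) (q : ℝ) (hq : L < q) :
    Integrable (fun t => (1 - exp (-δ * t)) ^ k * (exp (-q * t) * g t))
      (volume.restrict (Set.Ioi (0 : ℝ))) := by
  apply (gen_int hFpos hL0 hL q hq).bdd_mul (c := 1)
  · exact Continuous.aestronglyMeasurable (by fun_prop)
  · filter_upwards [ae_restrict_mem measurableSet_Ioi] with t ht
    have ht : 0 < t := ht
    have h1 : exp (-δ * t) ≤ 1 := exp_le_one_iff.2 (by nlinarith)
    have h2 := exp_pos (-δ * t)
    rw [norm_pow, Real.norm_of_nonneg (by linarith)]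
    exact pow_le_one₀ (by linarith) (by linarith)

lemma gen_dif (hFpos : ∀ x, 0 < x → 0 < F x) (hL0 : 0 ≤ L)
    (hL : ∀ q, L < q → ∫ t in Set.Ioi (0 : ℝ), exp (-q * t) * g t = F q) {δ : ℝ} (hδ : 0 < δ)
    (k : ℕ) (q : ℝ) (hq : L < q) :
    ∫ t in Set.Ioi (0 : ℝ), (1 - exp (-δ * t)) ^ k * (exp (-q * t) * g t) = Dif δ F k q := by
  induction k generalizing q with
  | zero => simpa [Dif] using hL q hq
  | succ k ih =>
    simp only [Dif]
    rw [← ih q hq, ← ih (q + δ) (by linarith), ← integral_sub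
      (gen_int_k hFpos hL0 hL hδ k q hq) (gen_int_k hFpos hL0 hL hδ k (q + δ) (by linarith))]
    congr 1; ext t
    rw [show -(q + δ) * t = -δ * t + -q * t by ring, exp_add]
    ring

lemma gen_nonneg_test (hF : ∀ n, CMon n F) (hFpos : ∀ x, 0 < x → 0 < F x) (hL0 : 0 ≤ L)
    (hL : ∀ q, L < q → ∫ t in Set.Ioi (0 : ℝ), exp (-q * t) * g t = F q)
    (φ : C(unitInterval, ℝ)) (hφ : ∀ x, 0 ≤ φ x) :
    0 ≤ ∫ t in Set.Ioi (0 : ℝ), φ (Set.projIcc 0 1 zero_le_one (exp (-1 * t))) *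
      (exp (-(L + 1) * t) * g t) := by
  have hint := gen_int hFpos hL0 hL (L + 1) (by linarith)
  have hcont : ∀ ψ : C(unitInterval, ℝ),
      Continuous (fun t : ℝ => ψ (Set.projIcc 0 1 zero_le_one (exp (-1 * t)))) := fun ψ =>
    ψ.continuous.comp (continuous_projIcc.comp (by fun_prop))
  have hu := bernsteinApproximation_uniform φ
  have ht : Tendsto (fun n : ℕ => ∫ t in Set.Ioi (0 : ℝ),
      bernsteinApproximation n φ (Set.projIcc 0 1 zero_le_one (exp (-1 * t))) *
      (exp (-(L + 1) * t) * g t)) atTop (nhds (∫ t in Set.Ioi (0 : ℝ),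
        φ (Set.projIcc 0 1 zero_le_one (exp (-1 * t))) * (exp (-(L + 1) * t) * g t))) := by
    apply tendsto_integral_filter_of_dominated_convergence
      (fun t => (‖φ‖ + 1) * ‖exp (-(L + 1) * t) * g t‖)
    · exact Eventually.of_forall fun n =>
        (hcont _).aestronglyMeasurable.mul hint.aestronglyMeasurable
    · have : ∀ᶠ n in atTop, ‖bernsteinApproximation n φ‖ < ‖φ‖ + 1 :=
        hu.norm.eventually (gt_mem_nhds (by linarith))
      filter_upwards [this] with n hn
      refine Eventually.of_forall fun t => ?_
      rw [norm_mul]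
      gcongr
      exact (ContinuousMap.norm_coe_le_norm _ _).trans hn.le
    · exact hint.norm.const_mul _
    · refine Eventually.of_forall fun t => ?_
      apply Tendsto.mul_const
      exact ((continuous_eval_const (F := C(unitInterval, ℝ)) (Set.projIcc 0 1 zero_le_one (exp (-1 * t)))).tendsto φ).comp hu
  apply ge_of_tendsto' ht
  intro n
  have hk : ∀ k : Fin (n + 1), ∀ t ∈ Set.Ioi (0 : ℝ),
      bernstein n k (Set.projIcc 0 1 zero_le_one (exp (-1 * t))) * φ (bernstein.z k) *
        (exp (-(L + 1) * t) * g t) = (n.choose k * φ (bernstein.z k)) *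
        ((1 - exp (-1 * t)) ^ (n - k : ℕ) * (exp (-(L + 1 + (k : ℕ)) * t) * g t)) := by
    intro k t ht
    have ht : 0 < t := ht
    have hx : ((Set.projIcc 0 1 zero_le_one (exp (-1 * t)) : unitInterval) : ℝ) =
        exp (-1 * t) := by
      rw [Set.projIcc_of_mem zero_le_one ⟨(exp_pos _).le, exp_le_one_iff.2 (by linarith)⟩]
    rw [bernstein_apply, hx, ← exp_nat_mul,
      show -(L + 1 + (k : ℕ)) * t = (k : ℕ) * (-1 * t) + -(L + 1) * t by ring, exp_add]
    ring
  have hLk : ∀ k : Fin (n + 1), L < L + 1 + ((k : ℕ) : ℝ) := fun k => by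
    have : (0 : ℝ) ≤ ((k : ℕ) : ℝ) := Nat.cast_nonneg _
    linarith
  have e : ∀ t ∈ Set.Ioi (0 : ℝ),
      bernsteinApproximation n φ (Set.projIcc 0 1 zero_le_one (exp (-1 * t))) *
      (exp (-(L + 1) * t) * g t) = ∑ k : Fin (n + 1), (n.choose k * φ (bernstein.z k)) *
        ((1 - exp (-1 * t)) ^ (n - k : ℕ) * (exp (-(L + 1 + (k : ℕ)) * t) * g t)) := by
    intro t ht
    rw [bernsteinApproximation.apply, Finset.sum_mul]
    exact Finset.sum_congr rfl fun k _ => hk k t ht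
  rw [setIntegral_congr_fun measurableSet_Ioi e, integral_finsetSum]
  · apply Finset.sum_nonneg
    intro k _
    rw [integral_const_mul, gen_dif hFpos hL0 hL one_pos _ _ (hLk k)]
    exact mul_nonneg (mul_nonneg (Nat.cast_nonneg _) (hφ _))
      (Dif_nonneg hF one_pos _ _ (by linarith [hLk k]))
  · intro k _
    exact (gen_int_k hFpos hL0 hL one_pos _ _ (hLk k)).const_mul _

lemma gen_nonneg (hF : ∀ n, CMon n F) (hFpos : ∀ x, 0 < x → 0 < F x) (hL0 : 0 ≤ L)
    (hL : ∀ q, L < q → ∫ t in Set.Ioi (0 : ℝ), exp (-q * t) * g t = F q)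
    (hg : ContinuousOn g (Set.Ioi 0)) (t₀ : ℝ) (ht₀ : 0 < t₀) : 0 ≤ g t₀ := by
  by_contra! hneg
  have hgc : ContinuousAt (fun x => g (-log x)) (exp (-t₀)) := by
    apply ContinuousAt.comp (g := g)
    · rw [log_exp, neg_neg]
      exact hg.continuousAt (Ioi_mem_nhds ht₀)
    · exact (continuousAt_log (exp_pos _).ne').neg
  have hev : ∀ᶠ x in nhds (exp (-t₀)), g (-log x) < 0 :=
    hgc.eventually (gt_mem_nhds (by simpa using hneg))
  obtain ⟨w, hw, hball⟩ := Metric.eventually_nhds_iff.1 hev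
  let φ : C(unitInterval, ℝ) := ⟨fun x => max 0 (w - |(x : ℝ) - exp (-t₀)|), by fun_prop⟩
  have h0 := gen_nonneg_test hF hFpos hL0 hL φ (fun x => le_max_left _ _)
  set G : ℝ → ℝ := fun t => max 0 (w - |exp (-t) - exp (-t₀)|) * (exp (-(L + 1) * t) * g t) with hG
  have e : ∀ t ∈ Set.Ioi (0 : ℝ), φ (Set.projIcc 0 1 zero_le_one (exp (-1 * t))) *
      (exp (-(L + 1) * t) * g t) = G t := by
    intro t ht
    have ht : 0 < t := ht
    rw [Set.projIcc_of_mem zero_le_one ⟨(exp_pos _).le, exp_le_one_iff.2 (by linarith)⟩]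
    simp [φ, hG]
  rw [setIntegral_congr_fun measurableSet_Ioi e] at h0
  have hGle : ∀ t, 0 < t → G t ≤ 0 := by
    intro t ht
    simp only [hG]
    by_cases h : |exp (-t) - exp (-t₀)| < w
    · have := @hball (exp (-t)) (by simpa [Real.dist_eq] using h)
      rw [log_exp, neg_neg] at this
      exact mul_nonpos_of_nonneg_of_nonpos (le_max_left _ _)
        (mul_nonpos_of_nonneg_of_nonpos (exp_pos _).le this.le)
    · rw [max_eq_left (by linarith)]
      simp
  have hGint : Integrable G (volume.restrict (Set.Ioi (0 : ℝ))) := by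
    apply (gen_int hFpos hL0 hL (L + 1) (by linarith)).bdd_mul (c := w)
    · exact Continuous.aestronglyMeasurable (by fun_prop)
    · refine Eventually.of_forall fun t => ?_
      rw [Real.norm_of_nonneg (le_max_left _ _)]
      exact max_le hw.le (by linarith [abs_nonneg (exp (-t) - exp (-t₀))])
  have hGcont : ContinuousOn G (Set.Ioi 0) := by
    apply ContinuousOn.mul
    · exact Continuous.continuousOn (by fun_prop)
    · exact ContinuousOn.mul (Continuous.continuousOn (by fun_prop)) hg
  have hnn : 0 ≤ᵐ[volume.restrict (Set.Ioi (0 : ℝ))] (fun t => -G t) := by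
    filter_upwards [ae_restrict_mem measurableSet_Ioi] with t ht
    have := hGle t ht
    simpa using this
  have hz : ∫ t in Set.Ioi (0 : ℝ), -G t = 0 := by
    apply le_antisymm
    · rw [integral_neg]; linarith
    · exact integral_nonneg_of_ae hnn
  rw [integral_eq_zero_iff_of_nonneg_ae hnn hGint.neg] at hz
  have := Measure.eqOn_open_of_ae_eq (μ := volume) hz isOpen_Ioi hGcont.neg continuousOn_const
  have h1 := this (show t₀ ∈ Set.Ioi 0 from ht₀)
  simp only [hG, sub_self, abs_zero, sub_zero, max_eq_right hw.le, Pi.zero_apply] at h1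
  have h2 := mul_pos hw (exp_pos (-(L + 1) * t₀))
  nlinarith

lemma gen_int_all (hF : ∀ n, CMon n F) (hFpos : ∀ x, 0 < x → 0 < F x) (hL0 : 0 ≤ L)
    (hL : ∀ q, L < q → ∫ t in Set.Ioi (0 : ℝ), exp (-q * t) * g t = F q)
    (hg : ContinuousOn g (Set.Ioi 0)) (p : ℝ) (hp : 0 < p) :
    Integrable (fun t => exp (-p * t) * g t) (volume.restrict (Set.Ioi (0 : ℝ))) := by
  have hg0 := gen_nonneg hF hFpos hL0 hL hg
  have hδ : 0 < L + 1 := by linarith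
  have hq : L < p + (L + 1) := by linarith
  set T : ℕ → ℝ → ℝ := fun k t => (1 - exp (-(L + 1) * t)) ^ k * (exp (-(p + (L + 1)) * t) * g t)
    with hT
  have hu : ∀ t : ℝ, 0 < t → 0 < exp (-(L + 1) * t) ∧ exp (-(L + 1) * t) < 1 := fun t ht =>
    ⟨exp_pos _, exp_lt_one_iff.2 (by nlinarith)⟩
  have hnorm : ∀ k, ∫ t in Set.Ioi (0 : ℝ), ‖T k t‖ = Dif (L + 1) F k (p + (L + 1)) := by
    intro k
    rw [← gen_dif hFpos hL0 hL hδ k _ hq]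
    apply setIntegral_congr_fun measurableSet_Ioi
    intro t ht
    have h1 := hu t ht
    have h2 := hg0 t ht
    apply Real.norm_of_nonneg
    exact mul_nonneg (pow_nonneg (by linarith) _) (mul_nonneg (exp_pos _).le h2)
  have hsum := hasSum_integral_of_summable_integral_norm (F := T)
    (μ := volume.restrict (Set.Ioi (0 : ℝ)))
    (fun k => gen_int_k hFpos hL0 hL hδ k _ hq) (by
      simp_rw [hnorm]
      apply summable_of_sum_range_le (c := F p)
      · exact fun k => Dif_nonneg hF hδ k _ (by linarith)
      · intro N
        have := Dif_sum F (L + 1) p N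
        have := Dif_nonneg hF hδ N p hp
        linarith)
  have e : ∀ t ∈ Set.Ioi (0 : ℝ), ∑' k, T k t = exp (-p * t) * g t := by
    intro t ht
    have h1 := hu t ht
    simp only [hT]
    rw [tsum_mul_right, tsum_geometric_of_lt_one (by linarith) (by linarith), sub_sub_cancel,
      show -(p + (L + 1)) * t = -(L + 1) * t + -p * t by ring, exp_add]
    have := h1.1.ne'
    field_simp
  rw [setIntegral_congr_fun measurableSet_Ioi e] at hsum
  apply Integrable.of_integral_ne_zero
  have hD : ∀ k, ∫ t in Set.Ioi (0 : ℝ), T k t = Dif (L + 1) F k (p + (L + 1)) :=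
    fun k => gen_dif hFpos hL0 hL hδ k _ hq
  have := hsum.summable.le_tsum 0 (fun k _ => by
    rw [hD]; exact Dif_nonneg hF hδ k _ (by linarith))
  rw [hsum.tsum_eq, hD] at this
  have h3 : 0 < F (p + (L + 1)) := hFpos _ (by linarith)
  simp only [Dif] at this
  linarith

lemma gen_eq (hF : ∀ n, CMon n F) (hFpos : ∀ x, 0 < x → 0 < F x) (hL0 : 0 ≤ L)
    (hL : ∀ q, L < q → ∫ t in Set.Ioi (0 : ℝ), exp (-q * t) * g t = F q)
    (hg : ContinuousOn g (Set.Ioi 0)) (hFa : AnalyticOnNhd ℝ F (Set.Ioi 0))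
    (p : ℝ) (hp : 0 < p) :
    ∫ t in Set.Ioi (0 : ℝ), exp (-p * t) * g t = F p := by
  have hg0 := gen_nonneg hF hFpos hL0 hL hg
  have hint := gen_int_all hF hFpos hL0 hL hg
  have hgm : AEMeasurable g (volume.restrict (Set.Ioi (0 : ℝ))) :=
    hg.aemeasurable measurableSet_Ioi
  set μ := (volume.restrict (Set.Ioi (0 : ℝ))).withDensity (fun t => ENNReal.ofReal (g t)) with hμ
  let X : ℝ → ℝ := fun t => -t
  have hmgf : ∀ q, ProbabilityTheory.mgf X μ q = ∫ t in Set.Ioi (0 : ℝ), exp (-q * t) * g t := by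
    intro q
    rw [ProbabilityTheory.mgf, hμ, integral_withDensity_eq_integral_toReal_smul₀
      hgm.ennreal_ofReal (by simp)]
    apply setIntegral_congr_fun measurableSet_Ioi
    intro t ht
    simp only [X, smul_eq_mul]
    rw [ENNReal.toReal_ofReal (hg0 t ht)]
    ring_nf
  have hsub : Set.Ioi (0 : ℝ) ⊆ interior (ProbabilityTheory.integrableExpSet X μ) := by
    apply interior_maximal _ isOpen_Ioi
    intro q hq
    show Integrable _ μ
    rw [hμ, integrable_withDensity_iff_integrable_smul₀' hgm.ennreal_ofReal (by simp)]
    refine (integrable_congr ?_).1 (hint q hq)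
    filter_upwards [ae_restrict_mem measurableSet_Ioi] with t ht
    simp only [X, smul_eq_mul]
    rw [ENNReal.toReal_ofReal (hg0 t ht)]
    ring_nf
  have hA : AnalyticOnNhd ℝ (ProbabilityTheory.mgf X μ) (Set.Ioi 0) :=
    ProbabilityTheory.analyticOnNhd_mgf.mono hsub
  have := hA.eqOn_of_preconnected_of_eventuallyEq hFa isPreconnected_Ioi
    (z₀ := L + 1) (show L + 1 ∈ Set.Ioi 0 by simp; linarith) (by
      filter_upwards [Ioi_mem_nhds (show L < L + 1 by linarith)] with q hq
      rw [hmgf, hL q hq])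
  rw [← hmgf]
  exact this hp

end generic

lemma neg_case (β l p : ℝ) (hβ : β ∈ Set.Ioo (0 : ℝ) 1) (hl : 0 < l) (hp : 0 < p) :
    ∫ t in Set.Ioi (0 : ℝ), exp (-p * t) * gker β (-l) t = 1 / (p ^ β + l) := by
  have h0 : ∀ x : ℝ, 0 < x → 0 < x ^ β + l := fun x hx => by
    have := rpow_pos_of_pos hx β
    positivity
  refine gen_eq (F := fun x => 1 / (x ^ β + l)) (L := l ^ (1 / β)) (CMon_F β l hβ hl.le)
    (fun x hx => one_div_pos.2 (h0 x hx)) (by positivity) ?_ (continuousOn_gker β _ hβ.1) ?_ p hp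
  · intro q hq
    have hL := rpow_pos_of_pos hl (1 / β)
    rw [direct β (-l) q hβ.1 (by linarith), sub_neg_eq_add]
    rw [abs_neg, abs_of_pos hl]
    have := rpow_lt_rpow hL.le hq hβ.1
    rwa [← rpow_mul hl.le, one_div, inv_mul_cancel₀ hβ.1.ne', rpow_one] at this
  · intro x hx
    have hx' : x ∈ Set.Ioi (0:ℝ) := hx
    have hx : 0 < x := hx
    have h1 : AnalyticAt ℝ (fun x : ℝ => x ^ β) x := by
      apply AnalyticAt.congr (f := fun x : ℝ => exp (log x * β))
      · exact ((analyticAt_log hx).mul analyticAt_const).rexp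
      · filter_upwards [Ioi_mem_nhds hx] with y hy
        rw [rpow_def_of_pos hy]
    exact analyticAt_const.div (h1.add analyticAt_const) (h0 x hx).ne'

theorem laplace_tempered_mittagLeffler_density
    (β ν : ℝ) (hβ : β ∈ Set.Ioo (0 : ℝ) 1) (hν : 0 < ν)
    (f : ℝ → ℝ)
    (hf : ∀ t, 0 < t →
      f t = Real.exp (-ν * t) * t ^ (β - 1) * mittagLeffler β β ((ν ^ β - 1) * t ^ β))
    (s : ℝ) (hs : 0 < s) :
    ∫ t in Set.Ioi (0 : ℝ), Real.exp (-s * t) * f t =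
      1 / (1 - ν ^ β + (ν + s) ^ β) := by
  have e : ∀ t ∈ Set.Ioi (0 : ℝ), Real.exp (-s * t) * f t =
      exp (-(ν + s) * t) * gker β (ν ^ β - 1) t := by
    intro t ht
    rw [hf t ht, gker, show -(ν + s) * t = -s * t + -ν * t by ring, exp_add]
    ring
  rw [setIntegral_congr_fun measurableSet_Ioi e]
  by_cases h : ν ^ β - 1 < 0
  · have := neg_case β (1 - ν ^ β) (ν + s) hβ (by linarith) (by linarith)
    rw [neg_sub] at this
    rw [this, add_comm]
  · rw [direct β _ (ν + s) hβ.1 (by linarith)]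
    · congr 1; ring
    · rw [abs_of_nonneg (by linarith)]
      have := rpow_lt_rpow hν.le (show ν < ν + s by linarith) hβ.1
      linarith
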